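/- Let G be a finite simple graph, let t ≥ 1 and k ≥ 2 be integers such that G contains no K_{t,t} subgraph, set α = 1/k, ℓ = 4k³ + 1, q = 4k⁴, and let D' ⊆ V(G) have the k-cover property. Let D_2 be the set of all vertices u such that some maximal k-dominating-sequence of some vertex ends with u. Then D_2 ⊆ D' ∪ 𝒫^{(≤t)}(D'). -/

import Mathlib

open Finset

variable {V : Type*}

/-- The closed neighborhood `N[v]` of a vertex as a `Finset`. -/
def closedNbhd [Fintype V] [DecidableEq V] (G : SimpleGraph V) [DecidableRel G.Adj]
    (v : V) : Finset V :=
  insert v (G.neighborFinset v)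

/-- The list `L = (v₁, …, vₘ)` is a pseudo-cover of `W` with parameters `(α, ℓ, q, k)`. -/
def PseudoCover [Fintype V] [DecidableEq V] (G : SimpleGraph V) [DecidableRel G.Adj]
    (α : ℝ) (ℓ q k : ℕ) (W : Finset V) (L : List V) : Prop :=
  L.length ≤ k ∧
  (W \ (L.toFinset.biUnion (closedNbhd G))).card ≤ q ∧
  ∀ i (hi : i < L.length),
    α * (((W \ ((L.take i).toFinset.biUnion (closedNbhd G))).card : ℝ)) ≤
      (((closedNbhd G (L.get ⟨i, hi⟩)) ∩
        (W \ ((L.take i).toFinset.biUnion (closedNbhd G)))).card : ℝ) ∧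
    ℓ ≤ ((closedNbhd G (L.get ⟨i, hi⟩)) ∩
        (W \ ((L.take i).toFinset.biUnion (closedNbhd G)))).card

/-- `𝒫(v)`: the set of vertices appearing in some pseudo-cover of `N(v)`,
when `|N(v)| > ℓ`, and `∅` otherwise. -/
def PCov [Fintype V] [DecidableEq V] (G : SimpleGraph V) [DecidableRel G.Adj]
    (α : ℝ) (ℓ q k : ℕ) (v : V) : Set V :=
  {u | ℓ < (G.neighborFinset v).card ∧
    ∃ L : List V, PseudoCover G α ℓ q k (G.neighborFinset v) L ∧ u ∈ L}

/-- `G` contains `K_{t,t}` as a subgraph. -/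
def HasKtt (G : SimpleGraph V) (t : ℕ) : Prop :=
  ∃ A B : Finset V, Disjoint A B ∧ A.card = t ∧ B.card = t ∧
    ∀ a ∈ A, ∀ b ∈ B, G.Adj a b

/-- `D'` has the `k`-cover property: for every vertex `v` there is `Z ⊆ D' \\ {v}`
with `|Z| ≤ k` and `N(v) ⊆ N[Z]`. -/
def KCoverProp [Fintype V] [DecidableEq V] (G : SimpleGraph V) [DecidableRel G.Adj]
    (D' : Finset V) (k : ℕ) : Prop :=
  ∀ v : V, ∃ Z : Finset V, Z ⊆ D'.erase v ∧ Z.card ≤ k ∧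
    G.neighborFinset v ⊆ Z.biUnion (closedNbhd G)

/-- `(vs 1, …, vs s)` is a `k`-dominating-sequence of `v` (with parameters
`α, ℓ, q, k, t`): the vertices are pairwise distinct, `vs 1 = v`, and there are sets
`B 1, …, B s` with `B 1 ⊆ N(vs 1)`, `B i ⊆ N(vs i) ∩ B (i-1)`,
`|B i| ≥ k^(t-i) * (2t - i + (t-i)q)` and `vs i ∈ 𝒫(vs (i-1))`. -/
def KDomSeq [Fintype V] [DecidableEq V] (G : SimpleGraph V) [DecidableRel G.Adj]
    (α : ℝ) (ℓ q k t : ℕ) (v : V) (s : ℕ) (vs : ℕ → V) : Prop :=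
  1 ≤ s ∧ vs 1 = v ∧
  (∀ i j, 1 ≤ i → i < j → j ≤ s → vs i ≠ vs j) ∧
  ∃ B : ℕ → Finset V,
    B 1 ⊆ G.neighborFinset (vs 1) ∧
    (∀ i, 2 ≤ i → i ≤ s → B i ⊆ G.neighborFinset (vs i) ∩ B (i - 1)) ∧
    (∀ i, 1 ≤ i → i ≤ s → k ^ (t - i) * (2 * t - i + (t - i) * q) ≤ (B i).card) ∧
    (∀ i, 2 ≤ i → i ≤ s → vs i ∈ PCov G α ℓ q k (vs (i - 1)))

/-- A maximal `k`-dominating-sequence: one that cannot be extended by any vertex. -/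
def MaxKDomSeq [Fintype V] [DecidableEq V] (G : SimpleGraph V) [DecidableRel G.Adj]
    (α : ℝ) (ℓ q k t : ℕ) (v : V) (s : ℕ) (vs : ℕ → V) : Prop :=
  KDomSeq G α ℓ q k t v s vs ∧
  ¬ ∃ u : V, KDomSeq G α ℓ q k t v (s + 1) (Function.update vs (s + 1) u)

/-- `D₂`: the set of all vertices `u` such that some maximal `k`-dominating-sequence of
some vertex ends with `u`. -/
def D2set [Fintype V] [DecidableEq V] (G : SimpleGraph V) [DecidableRel G.Adj]
    (α : ℝ) (ℓ q k t : ℕ) : Set V :=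
  {u | ∃ (v : V) (s : ℕ) (vs : ℕ → V), MaxKDomSeq G α ℓ q k t v s vs ∧ vs s = u}

/-- `𝒫(W) = ⋃ v ∈ W, 𝒫(v)`. -/
def PW [Fintype V] [DecidableEq V] (G : SimpleGraph V) [DecidableRel G.Adj]
    (α : ℝ) (ℓ q k : ℕ) (W : Set V) : Set V :=
  ⋃ v ∈ W, PCov G α ℓ q k v

/-- `𝒫^(i)(W)`, with the convention `𝒫^(0)(W) = W`. -/
def Piter [Fintype V] [DecidableEq V] (G : SimpleGraph V) [DecidableRel G.Adj]
    (α : ℝ) (ℓ q k : ℕ) (W : Set V) : ℕ → Set V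
  | 0 => W
  | (i + 1) => PW G α ℓ q k (Piter G α ℓ q k W i)

/-- `𝒫^(≤ t)(W) = ⋃_{1 ≤ j ≤ t} 𝒫^(j)(W)`. -/
def PleIter [Fintype V] [DecidableEq V] (G : SimpleGraph V) [DecidableRel G.Adj]
    (α : ℝ) (ℓ q k : ℕ) (W : Set V) (t : ℕ) : Set V :=
  ⋃ j ∈ Finset.Icc 1 t, Piter G α ℓ q k W j

section PseudoCovers

variable [Fintype V] [DecidableEq V] (G : SimpleGraph V) [DecidableRel G.Adj]

/-- Averaging: if `Z` covers the nonempty set `W` and `|Z| ≤ k`, some `N[z]` with `z ∈ Z`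
contains at least a `1 / k` fraction of `W`. -/
theorem exists_card_le_mul_card_closedNbhd_inter {k : ℕ} {W Z : Finset V} (hW : W.Nonempty)
    (hZ : Z.card ≤ k) (hcov : W ⊆ Z.biUnion (closedNbhd G)) :
    ∃ z ∈ Z, W.card ≤ k * (closedNbhd G z ∩ W).card := by
  by_contra! h
  have hle : W.card ≤ ∑ z ∈ Z, (closedNbhd G z ∩ W).card := by
    calc W.card ≤ (Z.biUnion fun z => closedNbhd G z ∩ W).card := by
          apply card_le_card
          intro w hw
          obtain ⟨z, hz, hwz⟩ := mem_biUnion.1 (hcov hw)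
          exact mem_biUnion.2 ⟨z, hz, mem_inter.2 ⟨hwz, hw⟩⟩
      _ ≤ _ := card_biUnion_le
  have hne : Z.Nonempty := by
    obtain ⟨w, hw⟩ := hW
    obtain ⟨z, hz, -⟩ := mem_biUnion.1 (hcov hw)
    exact ⟨z, hz⟩
  have hlt : ∑ z ∈ Z, k * (closedNbhd G z ∩ W).card < ∑ _z ∈ Z, W.card :=
    sum_lt_sum_of_nonempty hne h
  rw [← mul_sum, sum_const, smul_eq_mul] at hlt
  have h₁ := Nat.mul_le_mul_left k hle
  have h₂ := Nat.mul_le_mul_right W.card hZ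
  omega

theorem PseudoCover.cons {α : ℝ} {ℓ q k : ℕ} {W : Finset V} {z : V} {L : List V}
    (hL : PseudoCover G α ℓ q k (W \ closedNbhd G z) L) (hlen : L.length + 1 ≤ k)
    (hα : α * (W.card : ℝ) ≤ ((closedNbhd G z ∩ W).card : ℝ))
    (hℓ : ℓ ≤ (closedNbhd G z ∩ W).card) :
    PseudoCover G α ℓ q k W (z :: L) := by
  obtain ⟨-, hq, hstep⟩ := hL
  refine ⟨by simpa using hlen, ?_, ?_⟩
  · simpa [biUnion_insert, sdiff_sdiff_left] using hq
  · rintro (_ | i) hi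
    · simpa using ⟨hα, hℓ⟩
    · have := hstep i (by simpa using hi)
      simpa [biUnion_insert, sdiff_sdiff_left] using this

/-- The greedy construction: a set covered by at most `k` closed neighborhoods has a pseudo-cover
consisting of their centers. -/
theorem exists_pseudoCover_of_subset_biUnion {ℓ q k : ℕ} (hk : 0 < k) (hq : k * (ℓ - 1) ≤ q)
    (W Z : Finset V) (hZ : Z.card ≤ k) (hcov : W ⊆ Z.biUnion (closedNbhd G)) :
    ∃ L : List V, (∀ u ∈ L, u ∈ Z) ∧ L.length ≤ Z.card ∧
      PseudoCover G (1 / (k : ℝ)) ℓ q k W L := by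
  induction Z using Finset.strongInduction generalizing W with
  | H Z ih =>
    by_cases hWq : W.card ≤ q
    · exact ⟨[], by simp, by simp, by simp, by simpa using hWq, by simp⟩
    have hne : W.Nonempty := card_pos.1 (by omega)
    obtain ⟨z, hz, hzW⟩ := exists_card_le_mul_card_closedNbhd_inter G hne hZ hcov
    have hcard := card_erase_add_one hz
    obtain ⟨L, hLZ, hLlen, hL⟩ := ih (Z.erase z) (erase_ssubset hz) (W \ closedNbhd G z)
      (by omega) (by
        intro w hw
        obtain ⟨hw, hwz⟩ := mem_sdiff.1 hw
        obtain ⟨y, hy, hwy⟩ := mem_biUnion.1 (hcov hw)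
        refine mem_biUnion.2 ⟨y, mem_erase.2 ⟨?_, hy⟩, hwy⟩
        rintro rfl
        exact hwz hwy)
    refine ⟨z :: L, ?_, by simp; omega, hL.cons G (by omega) ?_ ?_⟩
    · intro u hu
      rcases List.mem_cons.1 hu with rfl | hu
      · exact hz
      · exact mem_of_mem_erase (hLZ u hu)
    · have hk' : (0 : ℝ) < k := by exact_mod_cast hk
      rw [one_div, inv_mul_le_iff₀ hk']
      exact_mod_cast hzW
    · have : ℓ - 1 < (closedNbhd G z ∩ W).card :=
        lt_of_mul_lt_mul_left (by omega : k * (ℓ - 1) < k * (closedNbhd G z ∩ W).card)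
          (Nat.zero_le k)
      omega

/-- If the neighborhood of a vertex `v` of large degree is covered by at most `k` closed
neighborhoods, then some center in `𝒫(v)` sees about a `1 / k` fraction of any given
large subset `B` of `N(v)`. -/
theorem exists_mem_PCov_card_le {ℓ q k : ℕ} (hk : 0 < k) (hq : k * (ℓ - 1) ≤ q) {v : V}
    {Z B : Finset V} (hZ : Z.card ≤ k) (hcov : G.neighborFinset v ⊆ Z.biUnion (closedNbhd G))
    (hdeg : ℓ < (G.neighborFinset v).card) (hB : B ⊆ G.neighborFinset v) (hBq : q < B.card) :
    ∃ z ∈ Z, z ∈ PCov G (1 / (k : ℝ)) ℓ q k v ∧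
      B.card ≤ k * ((G.neighborFinset z ∩ B).card + 1) + q := by
  obtain ⟨L, hLZ, -, hL⟩ := exists_pseudoCover_of_subset_biUnion G hk hq _ Z hZ hcov
  set C := L.toFinset.biUnion (closedNbhd G)
  have huncov : (B \ C).card ≤ q :=
    (card_le_card (sdiff_subset_sdiff hB subset_rfl)).trans hL.2.1
  have hsplit : (B \ C).card + (B ∩ C).card = B.card := card_sdiff_add_card_inter B C
  obtain ⟨z, hzL, hz⟩ := exists_card_le_mul_card_closedNbhd_inter G (W := B ∩ C)
    (Z := L.toFinset) (k := k) (card_pos.1 (by omega))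
    ((List.toFinset_card_le L).trans hL.1) inter_subset_right
  rw [List.mem_toFinset] at hzL
  refine ⟨z, hLZ z hzL, ⟨hdeg, L, hL, hzL⟩, ?_⟩
  have hle : (closedNbhd G z ∩ (B ∩ C)).card ≤ (G.neighborFinset z ∩ B).card + 1 := by
    refine (card_le_card (t := insert z (G.neighborFinset z ∩ B)) ?_).trans (card_insert_le _ _)
    intro w hw
    simp only [closedNbhd, mem_inter, mem_insert] at hw ⊢
    tauto
  have := Nat.mul_le_mul_left k hle
  omega

end PseudoCovers

section DominatingSequences

variable [Fintype V] [DecidableEq V] {G : SimpleGraph V} [DecidableRel G.Adj]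

/-- In a `K_{t,t}`-free graph a `k`-dominating-sequence has fewer than `t` terms. -/
theorem KDomSeq.length_lt {α : ℝ} {ℓ q k t s : ℕ} {v : V} {vs : ℕ → V}
    (h : KDomSeq G α ℓ q k t v s vs) (ht : 1 ≤ t) (hKtt : ¬ HasKtt G t) : s < t := by
  by_contra! hts
  obtain ⟨-, -, hinj, B, hB₁, hB, hcard, -⟩ := h
  have hBt : t ≤ (B t).card := by
    have := hcard t ht hts
    simp only [Nat.sub_self, pow_zero, zero_mul] at this
    omega
  obtain ⟨T, hT, hTcard⟩ := exists_subset_card_eq hBt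
  have hadj : ∀ j, 1 ≤ j → j ≤ t → ∀ i, 1 ≤ i → i ≤ j → ∀ b ∈ B j, G.Adj (vs i) b := by
    intro j hj
    induction j, hj using Nat.le_induction with
    | base =>
      intro _ i hi hi' b hb
      obtain rfl : i = 1 := by omega
      exact (G.mem_neighborFinset _ _).1 (hB₁ hb)
    | succ j hj ih =>
      intro hjt i hi hij b hb
      obtain ⟨hb₁, hb₂⟩ := mem_inter.1 (hB (j + 1) (by omega) (by omega) hb)
      rcases Nat.lt_or_ge j i with hlt | hle
      · obtain rfl : i = j + 1 := by omega
        exact (G.mem_neighborFinset _ _).1 hb₁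
      · exact ih (by omega) i hi hle b hb₂
  have hA : ∀ a ∈ (Icc 1 t).image vs, ∀ b ∈ T, G.Adj a b := by
    intro a ha b hb
    obtain ⟨i, hi, rfl⟩ := mem_image.1 ha
    rw [mem_Icc] at hi
    exact hadj t ht le_rfl i hi.1 hi.2 b (hT hb)
  refine hKtt ⟨(Icc 1 t).image vs, T, ?_, ?_, hTcard, hA⟩
  · exact disjoint_left.2 fun a ha hb => G.loopless.irrefl a (hA a ha a hb)
  · rw [card_image_of_injOn, Nat.card_Icc, Nat.add_sub_cancel]
    intro i hi j hj hij
    simp only [coe_Icc, Set.mem_Icc] at hi hj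
    rcases lt_trichotomy i j with hlt | heq | hgt
    · exact absurd hij (hinj i j hi.1 hlt (by omega))
    · exact heq
    · exact absurd hij.symm (hinj j i hj.1 hgt (by omega))

/-- Following a sequence with `vs i ∈ 𝒫(vs (i - 1))` from a vertex of `D` stays in the
iterates of `𝒫`. -/
theorem mem_Piter_of_forall_mem_PCov {α : ℝ} {ℓ q k s i : ℕ} {vs : ℕ → V} {D : Set V}
    (hP : ∀ i, 2 ≤ i → i ≤ s → vs i ∈ PCov G α ℓ q k (vs (i - 1))) (hi : 1 ≤ i)
    (hD : vs i ∈ D) (j : ℕ) (hj : i + j ≤ s) : vs (i + j) ∈ Piter G α ℓ q k D j := by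
  induction j with
  | zero => exact hD
  | succ j ih =>
    exact Set.mem_iUnion₂.2 ⟨_, ih (by omega), hP (i + (j + 1)) (by omega) hj⟩

/-- A `k`-dominating-sequence with a witness set for one more vertex can be extended. -/
theorem KDomSeq.extend {α : ℝ} {ℓ q k t s : ℕ} {v z : V} {vs : ℕ → V} {B : ℕ → Finset V}
    (hs : 1 ≤ s) (hv : vs 1 = v) (hinj : ∀ i j, 1 ≤ i → i < j → j ≤ s → vs i ≠ vs j)
    (hB₁ : B 1 ⊆ G.neighborFinset (vs 1))
    (hB : ∀ i, 2 ≤ i → i ≤ s → B i ⊆ G.neighborFinset (vs i) ∩ B (i - 1))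
    (hcard : ∀ i, 1 ≤ i → i ≤ s → k ^ (t - i) * (2 * t - i + (t - i) * q) ≤ (B i).card)
    (hP : ∀ i, 2 ≤ i → i ≤ s → vs i ∈ PCov G α ℓ q k (vs (i - 1)))
    (hne : ∀ i, 1 ≤ i → i ≤ s → vs i ≠ z) (hzP : z ∈ PCov G α ℓ q k (vs s))
    (hz : k ^ (t - (s + 1)) * (2 * t - (s + 1) + (t - (s + 1)) * q) ≤
      (G.neighborFinset z ∩ B s).card) :
    KDomSeq G α ℓ q k t v (s + 1) (Function.update vs (s + 1) z) := by
  have hold : ∀ i, i ≤ s → Function.update vs (s + 1) z i = vs i :=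
    fun i hi => Function.update_of_ne (by omega) _ _
  have holdB : ∀ i, i ≤ s →
      Function.update B (s + 1) (G.neighborFinset z ∩ B s) i = B i :=
    fun i hi => Function.update_of_ne (by omega) _ _
  refine ⟨by omega, by rw [hold 1 hs, hv], ?_,
    Function.update B (s + 1) (G.neighborFinset z ∩ B s), ?_, ?_, ?_, ?_⟩
  · intro i j hi hij hj
    rw [hold i (by omega)]
    rcases Nat.lt_or_ge s j with hlt | hle
    · obtain rfl : j = s + 1 := by omega
      rw [Function.update_self]
      exact hne i hi (by omega)
    · rw [hold j hle]
      exact hinj i j hi hij hle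
  · rwa [hold 1 hs, holdB 1 hs]
  · intro i hi his
    rw [holdB (i - 1) (by omega)]
    rcases Nat.lt_or_ge s i with hlt | hle
    · obtain rfl : i = s + 1 := by omega
      rw [Function.update_self, Function.update_self, Nat.add_sub_cancel]
    · rw [hold i hle, holdB i hle]
      exact hB i hi hle
  · intro i hi his
    rcases Nat.lt_or_ge s i with hlt | hle
    · obtain rfl : i = s + 1 := by omega
      rwa [Function.update_self]
    · rw [holdB i hle]
      exact hcard i hi hle
  · intro i hi his
    rw [hold (i - 1) (by omega)]
    rcases Nat.lt_or_ge s i with hlt | hle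
    · obtain rfl : i = s + 1 := by omega
      rwa [Function.update_self, Nat.add_sub_cancel]
    · rw [hold i hle]
      exact hP i hi hle

/-- In a graph with the `k`-cover property for `D'`, a maximal `k`-dominating-sequence with
fewer than `t` terms meets `D'`. -/
theorem MaxKDomSeq.exists_mem {ℓ q k t s : ℕ} {v : V} {vs : ℕ → V} {D' : Finset V}
    (h : MaxKDomSeq G (1 / (k : ℝ)) ℓ q k t v s vs) (hk : 0 < k) (hq : k * (ℓ - 1) ≤ q)
    (hℓ : ℓ ≤ q + 1) (hst : s < t) (hD' : KCoverProp G D' k) :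
    ∃ i, 1 ≤ i ∧ i ≤ s ∧ vs i ∈ D' := by
  obtain ⟨⟨hs, hv, hinj, B, hB₁, hB, hcard, hP⟩, hmax⟩ := h
  by_contra! hnot
  have hBs : B s ⊆ G.neighborFinset (vs s) := by
    rcases hs.eq_or_lt with rfl | hs'
    · exact hB₁
    · exact (hB s hs' le_rfl).trans inter_subset_left
  obtain ⟨Z, hZ, hZcard, hcov⟩ := hD' (vs s)
  set b := k ^ (t - (s + 1))
  set X := 2 * t - (s + 1) + (t - (s + 1)) * q
  have hb : 0 < b := pow_pos hk _
  have hlarge : k * b * (X + 1 + q) ≤ (B s).card := by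
    have hpow : k ^ (t - s) = k * b := by
      rw [show t - s = t - (s + 1) + 1 by omega, pow_succ, mul_comm]
    have hX : 2 * t - s + (t - s) * q = X + 1 + q := by
      rw [show t - s = t - (s + 1) + 1 by omega, add_mul, one_mul]
      omega
    simpa only [hpow, hX] using hcard s hs le_rfl
  have hkb : 1 ≤ k * b := Nat.mul_pos hk hb
  have hX : 1 ≤ X := by omega
  have hbig : X + 1 + q ≤ (B s).card := (Nat.le_mul_of_pos_left _ hkb).trans hlarge
  obtain ⟨z, hzZ, hzP, hz⟩ := exists_mem_PCov_card_le G hk hq hZcard hcov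
    (by have := card_le_card hBs; omega) hBs (by omega)
  have hzD : z ∈ D' := mem_of_mem_erase (hZ hzZ)
  refine hmax ⟨z, KDomSeq.extend hs hv hinj hB₁ hB hcard hP ?_ hzP ?_⟩
  · rintro i hi his rfl
    exact hnot i hi his hzD
  · change b * X ≤ _
    by_contra! hlt
    have h₁ : k * ((G.neighborFinset z ∩ B s).card + 1) ≤ k * (b * X) := Nat.mul_le_mul_left k hlt
    have h₂ : 1 + q ≤ k * b * (1 + q) := Nat.le_mul_of_pos_left _ hkb
    have h₃ : k * b * (X + 1 + q) = k * (b * X) + k * b * (1 + q) := by ring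
    omega

end DominatingSequences

/-- in a `K_{t,t}`-free graph where `D'` has the `k`-cover property,
the set `D₂` of last elements of maximal `k`-dominating-sequences satisfies
`D₂ ⊆ D' ∪ 𝒫^(≤t)(D')`. -/
theorem stmt10 [Fintype V] [DecidableEq V] (G : SimpleGraph V) [DecidableRel G.Adj]
    (t k : ℕ) (ht : 1 ≤ t) (hk : 2 ≤ k)
    (hKtt : ¬ HasKtt G t)
    (D' : Finset V) (hD' : KCoverProp G D' k) :
    D2set G (1 / (k : ℝ)) (4 * k ^ 3 + 1) (4 * k ^ 4) k t ⊆
      (D' : Set V) ∪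
        PleIter G (1 / (k : ℝ)) (4 * k ^ 3 + 1) (4 * k ^ 4) k (D' : Set V) t := by
  rintro u ⟨v, s, vs, hmax, rfl⟩
  have hst : s < t := hmax.1.length_lt ht hKtt
  obtain ⟨i, hi, his, hiD⟩ := hmax.exists_mem (by omega)
    (by rw [Nat.add_sub_cancel]; exact (by ring : k * (4 * k ^ 3) = 4 * k ^ 4).le)
    (by have : k ^ 3 ≤ k ^ 4 := Nat.pow_le_pow_right (by omega) (by omega)
        omega) hst hD'
  obtain ⟨-, -, -, -, -, -, -, hP⟩ := hmax.1
  have hmem := mem_Piter_of_forall_mem_PCov (D := (D' : Set V)) hP hi hiD (s - i) (by omega)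
  rw [Nat.add_sub_cancel' his] at hmem
  rcases his.eq_or_lt with rfl | hlt
  · exact Or.inl hiD
  · exact Or.inr (Set.mem_iUnion₂.2 ⟨s - i, Finset.mem_Icc.2 ⟨by omega, by omega⟩, hmem⟩)
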